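/- For τ in the upper half-plane, η(-1/τ) = √(-iτ) · η(τ), where the square root is taken with the principal branch. -/

import Mathlib

open Complex Real

/-- The Dedekind eta function on the upper half-plane. -/
noncomputable def dedekindEta (τ : ℂ) : ℂ :=
  Complex.exp (π * I * τ / 12) * ∏' n : ℕ, (1 - Complex.exp (2 * π * I * (n + 1) * τ))

/-- `dedekindEta` is Mathlib's Dedekind eta function. -/
lemma dedekindEta_eq_eta (τ : ℂ) : dedekindEta τ = ModularForm.eta τ := by
  simp only [dedekindEta, ModularForm.eta, ModularForm.eta_q_eq_cexp, Function.Periodic.qParam]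
  congr 2
  push_cast
  ring

/-- On the upper half-plane, the principal square roots satisfy `√τ = √I * √(-I * τ)`. -/
lemma cpow_half_eq_I_cpow_half_mul {τ : ℂ} (hτ : 0 < τ.im) :
    τ ^ (1 / 2 : ℂ) = I ^ (1 / 2 : ℂ) * (-I * τ) ^ (1 / 2 : ℂ) := by
  have hτ0 : τ ≠ 0 := by rintro rfl; simp at hτ
  have harg : |arg (-I * τ)| < π / 2 := by
    rw [abs_arg_lt_pi_div_two_iff]
    left
    simpa using hτ
  have hlog : Complex.log (I * (-I * τ)) = Complex.log I + Complex.log (-I * τ) := by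
    apply Complex.log_mul I_ne_zero (by simp [hτ0])
    rw [arg_I]
    constructor <;> linarith [Real.pi_pos, (abs_lt.mp harg).1, (abs_lt.mp harg).2]
  have hmul : I * (-I * τ) = τ := by
    linear_combination (-τ) * I_mul_I
  rw [hmul] at hlog
  rw [cpow_def_of_ne_zero hτ0, cpow_def_of_ne_zero I_ne_zero,
    cpow_def_of_ne_zero (mul_ne_zero (neg_ne_zero.mpr I_ne_zero) hτ0), hlog, add_mul,
    Complex.exp_add]

theorem dedekindEta_neg_inv (τ : ℂ) (hτ : 0 < τ.im) :
    dedekindEta (-τ⁻¹) = (-I * τ) ^ (1/2 : ℂ) * dedekindEta τ := by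
  have h := ModularForm.eta_comp_eq_csqrt_I_inv hτ
  have hI : I ^ (1 / 2 : ℂ) ≠ 0 := by simp [cpow_eq_zero_iff]
  simp only [Function.comp_apply, Pi.smul_apply, Pi.mul_apply, smul_eq_mul, Complex.sqrt] at h
  rw [dedekindEta_eq_eta, dedekindEta_eq_eta, show -τ⁻¹ = -1 / τ by ring, h,
    ← one_div (2 : ℂ), cpow_half_eq_I_cpow_half_mul hτ]
  field_simp
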